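/- Let 𝓖 be a minor-closed class of graphs such that every minimal forbidden minor of 𝓖 is 2-connected, and let s be the maximum integer such that K_{s,t} ∈ 𝓖 for every t ∈ ℕ. Then for every fixed forest T, the maximum number of copies of T over n-vertex graphs in 𝓖 is Θ(n^{α_s(T)}). -/

import Mathlib

open SimpleGraph

/-- The number of copies of `H` in `G`: subgraphs of `G` isomorphic to `H`. -/
noncomputable def numCopies {α β : Type*} (H : SimpleGraph α) (G : SimpleGraph β) : ℕ :=
  Nat.card {G' : G.Subgraph // Nonempty (G'.coe ≃g H)}

/-- `α_s(T)`: the maximum size of a stable set among the vertices of `T` of degree at most `s`. -/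
noncomputable def alphaDeg {V : Type*} (T : SimpleGraph V) (s : ℕ) : ℕ :=
  sSup {k | ∃ S : Finset V, S.card = k ∧ (∀ v ∈ S, (T.neighborSet v).ncard ≤ s) ∧
    ∀ u ∈ S, ∀ v ∈ S, ¬ T.Adj u v}

/-- A minor model of `H` in `G`. -/
def IsMinorModel {α β : Type*} (G : SimpleGraph α) (H : SimpleGraph β)
    (X : β → Set α) : Prop :=
  (∀ b, (G.induce (X b)).Connected) ∧
  (∀ b b', b ≠ b' → Disjoint (X b) (X b')) ∧
  (∀ b b', H.Adj b b' → ∃ a ∈ X b, ∃ a' ∈ X b', G.Adj a a')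

/-- `H` is a minor of `G`. -/
def HasMinor {α β : Type*} (G : SimpleGraph α) (H : SimpleGraph β) : Prop :=
  ∃ X : β → Set α, IsMinorModel G H X

/-- Membership of an arbitrary finite graph in a class of graphs indexed by `Fin n`. -/
def InClass (𝓖 : ∀ n : ℕ, SimpleGraph (Fin n) → Prop) {V : Type*} (G : SimpleGraph V) : Prop :=
  ∃ G' : SimpleGraph (Fin (Nat.card V)), Nonempty (G ≃g G') ∧ 𝓖 _ G'

/-- `𝓖` is minor-closed. -/
def MinorClosed (𝓖 : ∀ n : ℕ, SimpleGraph (Fin n) → Prop) : Prop :=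
  ∀ (m n : ℕ) (G : SimpleGraph (Fin m)) (H : SimpleGraph (Fin n)),
    𝓖 m G → HasMinor G H → 𝓖 n H

/-- `𝓖` is closed under 1-sums: if a graph is the union of two graphs in `𝓖` sharing at most
one vertex, then it is in `𝓖`. (Equivalent to all minimal forbidden minors being
2-connected.) -/
def OneSumClosed (𝓖 : ∀ n : ℕ, SimpleGraph (Fin n) → Prop) : Prop :=
  ∀ (V : Type) (_ : Finite V) (G : SimpleGraph V) (A B : Set V),
    A ∪ B = Set.univ → (A ∩ B).ncard ≤ 1 →
    (∀ u v, G.Adj u v → (u ∈ A ∧ v ∈ A) ∨ (u ∈ B ∧ v ∈ B)) →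
    InClass 𝓖 (G.induce A) → InClass 𝓖 (G.induce B) → InClass 𝓖 G

namespace HasMinor

variable {α β γ : Type*}

/-- A graph is a minor of any graph into which it maps injectively. -/
lemma of_hom {G : SimpleGraph α} {H : SimpleGraph β} (f : H →g G)
    (hf : Function.Injective f) : HasMinor G H := by
  refine ⟨fun b => {f b}, fun b => ?_, fun b b' h => ?_, fun b b' h => ?_⟩
  · exact Connected.of_subsingleton
  · simpa using fun h' => h (hf h')
  · exact ⟨_, rfl, _, rfl, f.map_adj h⟩

lemma trans {G : SimpleGraph α} {H : SimpleGraph β} {K : SimpleGraph γ}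
    (hGH : HasMinor G H) (hHK : HasMinor H K) : HasMinor G K := by
  obtain ⟨X, hXc, hXd, hXa⟩ := hGH
  obtain ⟨Y, hYc, hYd, hYa⟩ := hHK
  have hmem : ∀ c, ∀ b ∈ Y c, ∀ a ∈ X b, a ∈ ⋃ b ∈ Y c, X b := fun c b hb a ha =>
    Set.mem_biUnion hb ha
  have hin : ∀ c b (hb : b ∈ Y c) a a' (ha : a ∈ X b) (ha' : a' ∈ X b),
      (G.induce (⋃ b ∈ Y c, X b)).Reachable ⟨a, hmem c b hb a ha⟩ ⟨a', hmem c b hb a' ha'⟩ := by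
    intro c b hb a a' ha ha'
    exact ((hXc b).preconnected ⟨a, ha⟩ ⟨a', ha'⟩).map
      (induceHomOfLE G (fun x hx => hmem c b hb x hx)).toHom
  refine ⟨fun c => ⋃ b ∈ Y c, X b, fun c => ?_, fun c c' h => ?_, fun c c' h => ?_⟩
  · have key : ∀ u v : Y c, (H.induce (Y c)).Reachable u v →
        ∀ a (ha : a ∈ X u) a' (ha' : a' ∈ X v), (G.induce (⋃ b ∈ Y c, X b)).Reachable
          ⟨a, hmem c u u.2 a ha⟩ ⟨a', hmem c v v.2 a' ha'⟩ := by
      rintro u v ⟨p⟩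
      induction p with
      | nil => exact fun a ha a' ha' => hin c _ (Subtype.prop _) a a' ha ha'
      | @cons x y z hxy p ih =>
        intro a ha a' ha'
        obtain ⟨e, he, e', he', hee⟩ := hXa x y hxy
        refine (hin c x x.2 a e ha he).trans (Reachable.trans ?_ (ih e' he' a' ha'))
        exact Adj.reachable (by simpa using hee)
    obtain ⟨⟨b, hb⟩⟩ := (hYc c).nonempty
    obtain ⟨⟨a, ha⟩⟩ := (hXc b).nonempty
    refine (connected_iff _).2 ⟨?_, ⟨⟨a, hmem c b hb a ha⟩⟩⟩
    rintro ⟨x, hx⟩ ⟨y, hy⟩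
    obtain ⟨bx, hbx, hx'⟩ := Set.mem_iUnion₂.1 hx
    obtain ⟨bz, hby, hy'⟩ := Set.mem_iUnion₂.1 hy
    exact key ⟨bx, hbx⟩ ⟨bz, hby⟩ ((hYc c).preconnected _ _) x hx' y hy'
  · refine Set.disjoint_left.2 fun x hx hx' => ?_
    obtain ⟨b, hb, hxb⟩ := Set.mem_iUnion₂.1 hx
    obtain ⟨b', hb', hxb'⟩ := Set.mem_iUnion₂.1 hx'
    by_cases hbb : b = b'
    · subst hbb
      exact Set.disjoint_left.1 (hYd c c' h) hb hb'
    · exact Set.disjoint_left.1 (hXd b b' hbb) hxb hxb'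
  · obtain ⟨b, hb, b', hb', hbb⟩ := hYa c c' h
    obtain ⟨a, ha, a', ha', haa⟩ := hXa b b' hbb
    exact ⟨a, hmem c b hb a ha, a', hmem c' b' hb' a' ha', haa⟩

end HasMinor

lemma MinorClosed.inClass_of_hasMinor {𝓖 : ∀ n : ℕ, SimpleGraph (Fin n) → Prop}
    (h𝓖 : MinorClosed 𝓖) {α β : Type*} [Finite β] {G : SimpleGraph α} {H : SimpleGraph β}
    (hG : InClass 𝓖 G) (hGH : HasMinor G H) : InClass 𝓖 H := by
  obtain ⟨G', ⟨e⟩, hG'⟩ := hG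
  let f := Iso.map (Finite.equivFin β) H
  refine ⟨_, ⟨f⟩, h𝓖 _ _ G' _ hG' ?_⟩
  exact ((HasMinor.of_hom e.toHom e.injective).trans hGH).trans
    (HasMinor.of_hom f.symm.toHom f.symm.injective)

lemma HasMinor.top_succ_of_induce_neighborSet {V : Type*} {G : SimpleGraph V} {v : V} {r : ℕ}
    (h : HasMinor (G.induce {u | G.Adj v u}) (⊤ : SimpleGraph (Fin r))) :
    HasMinor G (⊤ : SimpleGraph (Fin (r + 1))) := by
  obtain ⟨X, hXc, hXd, hXa⟩ := h
  have hv : ∀ i, v ∉ Subtype.val '' X i := by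
    rintro i ⟨⟨x, hx⟩, -, hxv⟩
    exact G.ne_of_adj hx hxv.symm
  have hvX : ∀ i, ∃ a ∈ Subtype.val '' X i, G.Adj v a := fun i => by
    obtain ⟨⟨x, hx⟩⟩ := (hXc i).nonempty
    exact ⟨x, ⟨x, hx, rfl⟩, x.2⟩
  refine ⟨Fin.cases {v} fun i => Subtype.val '' X i, fun i => ?_, fun i j => ?_, fun i j => ?_⟩
  · refine Fin.cases ?_ (fun i => ?_) i
    · exact Connected.of_subsingleton (V := ({v} : Set V))
    · refine (hXc i).map (H := G.induce (Subtype.val '' X i))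
        ⟨fun x => ⟨x.1.1, x.1, x.2, rfl⟩, fun {a b} hab => hab⟩ ?_
      rintro ⟨_, x, hx, rfl⟩
      exact ⟨⟨x, hx⟩, rfl⟩
  · refine Fin.cases ?_ (fun i => ?_) i <;> refine Fin.cases ?_ (fun j => ?_) j
    · exact fun h => (h rfl).elim
    · exact fun _ => Set.disjoint_singleton_left.2 (hv j)
    · exact fun _ => Set.disjoint_singleton_right.2 (hv i)
    · intro h
      exact Set.disjoint_image_iff Subtype.val_injective |>.2
        (hXd i j fun hij => h (congrArg _ hij))
  · refine Fin.cases ?_ (fun i => ?_) i <;> refine Fin.cases ?_ (fun j => ?_) j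
    · exact fun h => (h rfl).elim
    · intro _
      obtain ⟨a, ha, hva⟩ := hvX j
      exact ⟨v, rfl, a, ha, hva⟩
    · intro _
      obtain ⟨a, ha, hva⟩ := hvX i
      exact ⟨a, ha, v, rfl, hva.symm⟩
    · intro h
      obtain ⟨a, ha, b, hb, hab⟩ := hXa i j fun hij => h (congrArg _ hij)
      exact ⟨a, ⟨a, ha, rfl⟩, b, ⟨b, hb, rfl⟩, hab⟩

namespace SimpleGraph

lemma mul_card_lt_ncard_adj {V : Type*} [Fintype V] [Nonempty V] (G : SimpleGraph V) {c : ℕ}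
    (h : ∀ u, c < {w | G.Adj u w}.ncard) :
    c * Fintype.card V < {p : V × V | G.Adj p.1 p.2}.ncard := by
  classical
  have hfib : ∀ u, {w | G.Adj u w}.ncard =
      ({p ∈ ({p : V × V | G.Adj p.1 p.2} : Finset (V × V)) | p.1 = u}).card := fun u => by
    rw [← Set.ncard_coe_finset, ← Set.ncard_image_of_injective _ (Prod.mk_right_injective u)]
    congr 1
    ext ⟨a, b⟩
    simp
    grind
  have hset : {p : V × V | G.Adj p.1 p.2}.ncard =
      ({p : V × V | G.Adj p.1 p.2} : Finset (V × V)).card := by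
    rw [← Set.ncard_coe_finset]
    simp
  rw [hset, Finset.card_eq_sum_card_fiberwise (f := Prod.fst) (t := Finset.univ) (by simp)]
  calc c * Fintype.card V = ∑ _u : V, c := by simp [mul_comm]
    _ < _ := Finset.sum_lt_sum_of_nonempty Finset.univ_nonempty fun u _ => hfib u ▸ h u

/-- A finite graph without `K_r` minor has linearly many adjacent pairs. -/
theorem exists_card_adj_le_of_not_hasMinor_top (r : ℕ) :
    ∃ c : ℕ, ∀ (n : ℕ) (V : Type*) [Fintype V] (G : SimpleGraph V), Fintype.card V = n →
      ¬ HasMinor G (⊤ : SimpleGraph (Fin r)) →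
      {p : V × V | G.Adj p.1 p.2}.ncard ≤ c * n := by
  classical
  induction r with
  | zero =>
    refine ⟨0, fun n V _ G _ h => (h ?_).elim⟩
    exact ⟨fun _ => ∅, fun b => b.elim0, fun b => b.elim0, fun b => b.elim0⟩
  | succ r ih =>
    obtain ⟨c, hc⟩ := ih
    refine ⟨2 * c + 2, fun n => ?_⟩
    induction n with
    | zero =>
      intro V _ G hV _
      have := Fintype.card_eq_zero_iff.1 hV
      simp [Set.eq_empty_of_isEmpty]
    | succ n ihn =>
      intro V _ G hV hG
      by_cases hE : ∀ x y, ¬ G.Adj x y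
      · simp [hE]
      push Not at hE
      obtain ⟨v, u₀, hvu₀⟩ := hE
      by_cases hcom : ∃ u, G.Adj v u ∧ {w | G.Adj v w ∧ G.Adj u w}.ncard ≤ c
      · -- contract the edge `uv`
        obtain ⟨u, hvu, hcu⟩ := hcom
        let W := {x : V // x ≠ u}
        let π : V → W := fun x => if h : x = u then ⟨v, hvu.ne⟩ else ⟨x, h⟩
        let H : SimpleGraph W := SimpleGraph.fromRel fun a b => ∃ x y, π x = a ∧ π y = b ∧ G.Adj x y
        have hHadj : ∀ x y, G.Adj x y → π x ≠ π y → H.Adj (π x) (π y) := fun x y hxy hne =>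
          (fromRel_adj _ _ _).2 ⟨hne, Or.inl ⟨x, y, rfl, rfl, hxy⟩⟩
        have hπv : ∀ x, (π x : V) = if x = u then v else x := fun x => by
          by_cases h : x = u <;> simp [π, h]
        have hWc : Fintype.card W = n := by
          simp [W, Fintype.card_subtype_compl, hV]
        have hminor : HasMinor G H := by
          refine ⟨fun a => {x | π x = a}, fun a => ?_, fun a b hab => ?_, fun a b hab => ?_⟩
          · by_cases ha : a = ⟨v, hvu.ne⟩
            · have : {x | π x = a} = {v, u} := by
                ext x
                simp only [Set.mem_ofPred_eq, Set.mem_insert_iff, Set.mem_singleton_iff, ha]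
                grind
              change (G.induce {x | π x = a}).Connected
              rw [this]
              exact induce_pair_connected_of_adj hvu
            · have : {x | π x = a} = {a.1} := by
                ext x
                have := a.2
                have hav : a.1 ≠ v := fun h => ha (Subtype.ext h)
                simp only [Set.mem_ofPred_eq, Set.mem_singleton_iff]
                grind
              change (G.induce {x | π x = a}).Connected
              rw [this]
              exact Connected.of_subsingleton
          · exact Set.disjoint_left.2 fun x hx hx' => hab (hx.symm.trans hx')
          · obtain ⟨-, ⟨x, y, hx, hy, h⟩ | ⟨x, y, hx, hy, h⟩⟩ := (fromRel_adj _ _ _).1 hab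
            · exact ⟨x, hx, y, hy, h⟩
            · exact ⟨y, hy, x, hx, h.symm⟩
        have hH := ihn W H hWc fun h => hG (hminor.trans h)
        let C := {w | G.Adj v w ∧ G.Adj u w}
        let E₀ : Set (V × V) := insert (u, v) (insert (v, u)
          ((fun w => (u, w)) '' C ∪ (fun w => (w, u)) '' C))
        have hE₀ : E₀.ncard ≤ 2 * c + 2 := by
          have h1 := Set.ncard_insert_le (u, v) (insert (v, u)
            ((fun w => (u, w)) '' C ∪ (fun w => (w, u)) '' C))
          have h2 := Set.ncard_insert_le (v, u) ((fun w => (u, w)) '' C ∪ (fun w => (w, u)) '' C)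
          have h3 := Set.ncard_union_le ((fun w => (u, w)) '' C) ((fun w => (w, u)) '' C)
          have h4 := Set.ncard_image_le (f := fun w => (u, w)) (Set.toFinite C)
          have h5 := Set.ncard_image_le (f := fun w => (w, u)) (Set.toFinite C)
          have h6 : C.ncard ≤ c := hcu
          simp only [E₀]
          omega
        have hdiff : ({p : V × V | G.Adj p.1 p.2} \ E₀).ncard ≤
            {p : W × W | H.Adj p.1 p.2}.ncard := by
          refine Set.ncard_le_ncard_of_injOn (fun p => (π p.1, π p.2)) ?_ ?_ (Set.toFinite _)
          · rintro ⟨x, y⟩ ⟨hxy, hn⟩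
            refine hHadj x y hxy fun h => hn ?_
            have hxy' : G.Adj x y := hxy
            have := hxy'.ne
            rw [Subtype.ext_iff, hπv, hπv] at h
            simp only [E₀, Set.mem_insert_iff, Prod.mk.injEq]
            grind
          · rintro ⟨x, y⟩ ⟨hxy, hn⟩ ⟨x', y'⟩ ⟨hxy', hn'⟩ h
            simp only [Prod.mk.injEq] at h
            simp only [E₀, C, Set.mem_insert_iff, Prod.mk.injEq, Set.mem_union, Set.mem_image,
              Set.mem_ofPred_eq] at hn hn' hxy hxy' ⊢
            have := G.symm.symm
            have := G.loopless.irrefl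
            grind
        have := Set.ncard_le_ncard_sdiff_add_ncard {p : V × V | G.Adj p.1 p.2} E₀ (Set.toFinite _)
        nlinarith
      · -- the neighbourhood of `v` is dense
        push Not at hcom
        have hN : ¬ HasMinor (G.induce {u | G.Adj v u}) (⊤ : SimpleGraph (Fin r)) :=
          fun h => hG h.top_succ_of_induce_neighborSet
        have h1 := hc _ _ (G.induce {u | G.Adj v u}) rfl hN
        have : Nonempty {u | G.Adj v u} := ⟨⟨u₀, hvu₀⟩⟩
        have h2 := mul_card_lt_ncard_adj (G.induce {u | G.Adj v u}) (c := c) (by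
          rintro ⟨u, hu⟩
          refine (hcom u hu).trans_le ?_
          rw [← Set.ncard_image_of_injective _ Subtype.val_injective]
          refine Set.ncard_le_ncard ?_ (Set.toFinite _)
          rintro w ⟨hvw, huw⟩
          exact ⟨⟨w, hvw⟩, huw, rfl⟩)
        omega

variable {V W : Type*} {G : SimpleGraph V}

lemma Connected.induce_insert {Q : Set V} (hQ : (G.induce Q).Connected) {w q : V} (hq : q ∈ Q)
    (h : G.Adj w q) : (G.induce (insert w Q)).Connected := by
  have : insert w Q = {w, q} ∪ Q := by
    ext x
    simp only [Set.mem_insert_iff, Set.mem_union, Set.mem_singleton_iff]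
    grind
  rw [this]
  exact induce_union_connected (induce_pair_connected_of_adj h).preconnected hQ.preconnected
    ⟨q, by simp, hq⟩

/-- In a forest, a vertex outside a connected set has at most one neighbour in it. -/
lemma IsAcyclic.eq_of_adj_of_connected_induce (hG : G.IsAcyclic) {Q : Set V}
    (hQ : (G.induce Q).Connected) {w a b : V} (hw : w ∉ Q) (ha : a ∈ Q) (hb : b ∈ Q)
    (hwa : G.Adj w a) (hwb : G.Adj w b) : a = b := by
  by_contra hab
  refine isBridge_iff.1 (isAcyclic_iff_forall_adj_isBridge.1 hG hwa) ?_
  have h1 : (G.deleteEdges {s(w, a)}).Reachable b a :=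
    (hQ.preconnected ⟨b, hb⟩ ⟨a, ha⟩).map ⟨Subtype.val, fun {x y} hxy => by
      refine deleteEdges_adj.2 ⟨hxy, ?_⟩
      have := x.2
      have := y.2
      simp only [Set.mem_singleton_iff, Sym2.eq_iff]
      rintro (⟨h, -⟩ | ⟨-, h⟩) <;> simp_all⟩
  refine Reachable.trans (Adj.reachable (deleteEdges_adj.2 ⟨hwb, ?_⟩)) h1
  have := hwb.ne
  simp only [Set.mem_singleton_iff, Sym2.eq_iff]
  grind

/-- Every nonempty finite vertex set of a forest contains a vertex with at most one neighbour
inside the set. -/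
lemma IsAcyclic.exists_mem_subsingleton_neighbors (hG : G.IsAcyclic) {L : Finset V}
    (hL : L.Nonempty) :
    ∃ x ∈ L, ∀ a ∈ L, ∀ b ∈ L, G.Adj x a → G.Adj x b → a = b := by
  classical
  let 𝓠 : Finset (Finset V) := {Q ∈ L.powerset | (G.induce (Q : Set V)).Connected ∧
    ∃ x ∈ Q, ∀ a ∈ Q, ∀ b ∈ Q, G.Adj x a → G.Adj x b → a = b}
  obtain ⟨y, hy⟩ := hL
  have hne : 𝓠.Nonempty := by
    refine ⟨{y}, Finset.mem_filter.2 ⟨by simpa using hy, ?_, y, by simp, by simp⟩⟩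
    rw [Finset.coe_singleton]
    exact Connected.of_subsingleton
  obtain ⟨Q, hQ, hmax⟩ := 𝓠.exists_max_image Finset.card hne
  obtain ⟨hQL, hQc, x, hxQ, hx⟩ := Finset.mem_filter.1 hQ
  rw [Finset.mem_powerset] at hQL
  have key : ∀ a ∈ L, G.Adj x a → a ∈ Q := by
    intro a haL hxa
    by_contra haQ
    have := hmax (insert a Q) (Finset.mem_filter.2 ⟨?_, ?_, a, by simp, ?_⟩)
    · rw [Finset.card_insert_of_notMem haQ] at this
      omega
    · exact Finset.mem_powerset.2 (Finset.insert_subset haL hQL)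
    · rw [Finset.coe_insert]
      exact hQc.induce_insert hxQ hxa.symm
    · intro b hb c hc hab hac
      rcases Finset.mem_insert.1 hb with rfl | hb
      · exact (hab.ne rfl).elim
      rcases Finset.mem_insert.1 hc with rfl | hc
      · exact (hac.ne rfl).elim
      exact hG.eq_of_adj_of_connected_induce hQc haQ hb hc hab hac
  exact ⟨x, hQL hxQ, fun a ha b hb hxa hxb => hx a (key a ha hxa) b (key b hb hxb) hxa hxb⟩

/-- In a forest, a stable set `S ⊆ L` bounds the number of restrictions to `L` of homomorphisms
to a sparse graph. -/
lemma IsAcyclic.exists_stable_card_restrict_le [Finite W] {T : SimpleGraph W} (hT : T.IsAcyclic)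
    [Fintype V] {D : ℕ} (hV : Fintype.card V ≤ D) (hE : {p : V × V | G.Adj p.1 p.2}.ncard ≤ D)
    (L : Finset W) :
    ∃ S ⊆ L, (∀ u ∈ S, ∀ v ∈ S, ¬ T.Adj u v) ∧ ∃ P : Finset (W → V), P.card ≤ D ^ S.card ∧
      ∀ f : T →g G, ∃ p ∈ P, ∀ x ∈ L, p x = f x := by
  classical
  induction L using Finset.strongInduction with
  | H L ih =>
  obtain rfl | hL := L.eq_empty_or_nonempty
  · refine ⟨∅, by simp, by simp, ?_⟩
    by_cases h : Nonempty (T →g G)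
    · obtain ⟨f⟩ := h
      exact ⟨{⇑f}, by simp, by simp⟩
    · exact ⟨∅, by simp, fun f => (h ⟨f⟩).elim⟩
  obtain ⟨x, hxL, hx⟩ := hT.exists_mem_subsingleton_neighbors hL
  by_cases hu : ∃ u ∈ L, T.Adj x u
  · obtain ⟨u, huL, hxu⟩ := hu
    obtain ⟨S, hSL, hS, P, hP, hf⟩ := ih ((L.erase x).erase u)
      ((Finset.erase_subset _ _).trans_ssubset (Finset.erase_ssubset hxL))
    have hxS : x ∉ S := fun h => by simpa using hSL h
    have hnS : ∀ v ∈ S, ¬ T.Adj x v := fun v hv hxv => by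
      have := hSL hv
      simp only [Finset.mem_erase] at this
      exact this.1 (hx _ this.2.2 _ huL hxv hxu)
    refine ⟨insert x S, ?_, ?_, Finset.image₂ (fun p (e : V × V) =>
      Function.update (Function.update p x e.1) u e.2) P
        ({p | G.Adj p.1 p.2} : Finset (V × V)), ?_, fun f => ?_⟩
    · exact Finset.insert_subset hxL
        (hSL.trans ((Finset.erase_subset _ _).trans (Finset.erase_subset _ _)))
    · simp only [Finset.mem_insert]
      rintro a (rfl | ha) b (rfl | hb)
      · exact T.loopless.irrefl _
      · exact hnS b hb
      · exact fun h => hnS a ha h.symm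
      · exact hS a ha b hb
    · rw [Finset.card_insert_of_notMem hxS, pow_succ]
      refine (Finset.card_image₂_le _ _ _).trans (Nat.mul_le_mul hP ?_)
      rw [← Set.ncard_coe_finset]
      simpa using hE
    · obtain ⟨p, hp, hpf⟩ := hf f
      refine ⟨_, Finset.mem_image₂_of_mem hp (b := (f x, f u)) (by simpa using f.map_adj hxu), ?_⟩
      intro y hy
      by_cases hyu : y = u
      · simp [hyu]
      by_cases hyx : y = x
      · simp [hyx, hxu.ne]
      · simpa [hyu, hyx] using hpf y (by simp [hyu, hyx, hy])
  · push Not at hu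
    obtain ⟨S, hSL, hS, P, hP, hf⟩ := ih (L.erase x) (Finset.erase_ssubset hxL)
    have hxS : x ∉ S := fun h => by simpa using hSL h
    have hnS : ∀ v ∈ S, ¬ T.Adj x v := fun v hv => hu v (Finset.mem_of_mem_erase (hSL hv))
    refine ⟨insert x S, ?_, ?_, Finset.image₂ (fun p (v : V) => Function.update p x v) P
      Finset.univ, ?_, fun f => ?_⟩
    · exact Finset.insert_subset hxL (hSL.trans (Finset.erase_subset _ _))
    · simp only [Finset.mem_insert]
      rintro a (rfl | ha) b (rfl | hb)
      · exact T.loopless.irrefl _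
      · exact hnS b hb
      · exact fun h => hnS a ha h.symm
      · exact hS a ha b hb
    · rw [Finset.card_insert_of_notMem hxS, pow_succ]
      exact (Finset.card_image₂_le _ _ _).trans (Nat.mul_le_mul hP hV)
    · obtain ⟨p, hp, hpf⟩ := hf f
      refine ⟨_, Finset.mem_image₂_of_mem hp (b := f x) (by simp), fun y hy => ?_⟩
      by_cases hyx : y = x
      · simp [hyx]
      · simpa [hyx] using hpf y (by simp [hyx, hy])

/-- In a forest, a set of vertices of degree more than `s ≥ 1` contains a connected set having at
least `s + 1` neighbours, all of them outside the given set. -/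
lemma IsAcyclic.exists_connected_lt_ncard_neighbors [Finite V] (hG : G.IsAcyclic) {s : ℕ}
    (hs : 1 ≤ s) {R : Set V} (hR : R ≠ Set.univ) (hdeg : ∀ v ∉ R, s < (G.neighborSet v).ncard) :
    ∃ Q : Set V, (G.induce Q).Connected ∧ Q ⊆ Rᶜ ∧
      {w | w ∉ Q ∧ ∃ q ∈ Q, G.Adj q w} ⊆ R ∧ s < {w | w ∉ Q ∧ ∃ q ∈ Q, G.Adj q w}.ncard := by
  classical
  let N : Set V → Set V := fun Q => {w | w ∉ Q ∧ ∃ q ∈ Q, G.Adj q w}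
  let 𝓠 : Set (Set V) := {Q | (G.induce Q).Connected ∧ Q ⊆ Rᶜ ∧ s < (N Q).ncard}
  obtain ⟨x, hx⟩ := (Set.ne_univ_iff_exists_notMem _).1 hR
  have hne : 𝓠.Nonempty := by
    refine ⟨{x}, Connected.of_subsingleton, by simpa using hx, ?_⟩
    have : N {x} = G.neighborSet x := by
      ext w
      simp only [N, Set.mem_singleton_iff, exists_eq_left, mem_neighborSet, Set.mem_ofPred_eq]
      exact ⟨fun h => h.2, fun h => ⟨h.ne', h⟩⟩
    rw [this]
    exact hdeg x hx
  obtain ⟨Q, hQ⟩ := (Set.toFinite 𝓠).exists_maximal hne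
  obtain ⟨hQc, hQR, hQs⟩ := hQ.prop
  refine ⟨Q, hQc, hQR, ?_, hQs⟩
  rintro w ⟨hwQ, q, hq, hqw⟩
  by_contra hwR
  have hQ'c := hQc.induce_insert hq hqw.symm
  obtain ⟨w', hw', hw'q⟩ : ∃ w' ∈ G.neighborSet w, w' ≠ q :=
    Set.exists_ne_of_one_lt_ncard (hs.trans_lt (hdeg w hwR)) q
  have hw'Q : w' ∉ Q := fun h =>
    hw'q (hG.eq_of_adj_of_connected_induce hQc hwQ h hq hw' hqw.symm)
  have hw'Q' : w' ∉ insert w Q := fun h => (Set.mem_insert_iff.1 h).elim hw'.ne' hw'Q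
  have hw'N : w' ∉ N Q := by
    rintro ⟨-, b, hb, hbw'⟩
    have := hG.eq_of_adj_of_connected_induce hQ'c hw'Q' (Set.mem_insert _ _)
      (Set.mem_insert_of_mem _ hb) hw'.symm hbw'.symm
    exact hwQ (this ▸ hb)
  have hsub : insert w' (N Q \ {w}) ⊆ N (insert w Q) := by
    refine Set.insert_subset ⟨hw'Q', w, Set.mem_insert _ _, hw'⟩ ?_
    rintro y ⟨⟨hyQ, b, hb, hby⟩, hyw⟩
    exact ⟨fun h => (Set.mem_insert_iff.1 h).elim hyw hyQ, b, Set.mem_insert_of_mem _ hb, hby⟩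
  have hmem : insert w Q ∈ 𝓠 := by
    refine ⟨hQ'c, Set.insert_subset hwR hQR, hQs.trans_le ?_⟩
    refine le_trans (le_of_eq ?_) (Set.ncard_le_ncard hsub (Set.toFinite _))
    rw [Set.ncard_insert_of_notMem (fun h => hw'N h.1) (Set.toFinite _),
      Set.ncard_sdiff_singleton_add_one (show w ∈ N Q from ⟨hwQ, q, hq, hqw⟩) (Set.toFinite _)]
  exact hwQ (hQ.le_of_ge hmem (Set.subset_insert _ _) (Set.mem_insert _ _))

end SimpleGraph

/-- A sunflower lemma for functions: among many functions agreeing on `R` there are `t` that agree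
on some `R' ⊇ R` and whose ranges on the complement of `R'` are pairwise disjoint. -/
lemma exists_sunflower {ι V : Type*} [Fintype ι] [DecidableEq ι] (t : ℕ) (R : Finset ι)
    (F : Finset (ι → V)) (hF : ∀ f ∈ F, ∀ g ∈ F, ∀ x ∈ R, f x = g x)
    (hcard : (Fintype.card ι * (Fintype.card ι * t)) ^ Rᶜ.card < F.card) :
    ∃ R', R ⊆ R' ∧ R' ≠ Finset.univ ∧ ∃ C ⊆ F, t ≤ C.card ∧
      (∀ f ∈ C, ∀ g ∈ C, ∀ x ∈ R', f x = g x) ∧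
      ∀ f ∈ C, ∀ g ∈ C, f ≠ g → ∀ x ∉ R', ∀ y ∉ R', f x ≠ g y := by
  classical
  induction hj : Rᶜ.card generalizing R F with
  | zero =>
    rw [hj, pow_zero, Finset.one_lt_card] at hcard
    obtain ⟨f, hf, g, hg, hfg⟩ := hcard
    have hR : R = Finset.univ := by simpa using hj
    exact (hfg (funext fun x => hF f hf g hg x (by simp [hR]))).elim
  | succ j ih =>
    obtain ⟨x₀, hx₀⟩ : Rᶜ.Nonempty := Finset.card_pos.1 (by omega)
    rw [Finset.mem_compl] at hx₀
    let 𝓒 := {C ∈ F.powerset | ∀ f ∈ C, ∀ g ∈ C, f ≠ g → ∀ x ∉ R, ∀ y ∉ R, f x ≠ g y}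
    obtain ⟨C, hC, hmax⟩ := 𝓒.exists_max_image Finset.card ⟨∅, by simp [𝓒]⟩
    obtain ⟨hCF, hCd⟩ := Finset.mem_filter.1 hC
    rw [Finset.mem_powerset] at hCF
    by_cases htC : t ≤ C.card
    · exact ⟨R, subset_rfl, fun h => hx₀ (by simp [h]), C, hCF, htC,
        fun f hf g hg => hF f (hCF hf) g (hCF hg), hCd⟩
    have hhit : ∀ f ∈ F, ∃ z : ι × ι × (ι → V), z.2.2 ∈ C ∧ z.1 ∉ R ∧ f z.1 = z.2.2 z.2.1 := by
      intro f hf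
      by_cases hfC : f ∈ C
      · exact ⟨(x₀, x₀, f), hfC, hx₀, rfl⟩
      by_contra! hno
      have := hmax (insert f C) (Finset.mem_filter.2
        ⟨Finset.mem_powerset.2 (Finset.insert_subset hf hCF), ?_⟩)
      · rw [Finset.card_insert_of_notMem hfC] at this
        omega
      · intro g hg g' hg' hne x hx y hy
        rw [Finset.mem_insert] at hg hg'
        rcases hg with rfl | hg <;> rcases hg' with rfl | hg'
        · exact (hne rfl).elim
        · exact hno (x, y, g') hg' hx
        · exact (hno (y, x, g) hg hy).symm
        · exact hCd g hg g' hg' hne x hx y hy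
    obtain ⟨f₁, -⟩ := Finset.card_pos.1 (Nat.zero_lt_of_lt hcard)
    have : Nonempty (ι × ι × (ι → V)) := ⟨(x₀, x₀, f₁)⟩
    choose! z hzC hzR hz using hhit
    have hmaps : ∀ f ∈ F, z f ∈ (Finset.univ ×ˢ Finset.univ ×ˢ C : Finset (ι × ι × (ι → V))) :=
      fun f hf => by simpa using hzC f hf
    obtain ⟨a, -, ha⟩ := Finset.exists_lt_card_fiber_of_mul_lt_card_of_maps_to hmaps
      (n := (Fintype.card ι * (Fintype.card ι * t)) ^ j) (by
        rw [hj, pow_succ'] at hcard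
        refine lt_of_le_of_lt ?_ hcard
        simp only [Finset.card_product, Finset.card_univ]
        gcongr
        omega)
    obtain ⟨f₀, hf₀⟩ := Finset.card_pos.1 (Nat.zero_lt_of_lt ha)
    have haR : a.1 ∉ R := by
      obtain ⟨hf₀F, rfl⟩ := Finset.mem_filter.1 hf₀
      exact hzR f₀ hf₀F
    have hcard' : (insert a.1 R)ᶜ.card = j := by
      rw [Finset.card_compl, Finset.card_insert_of_notMem haR, ← Nat.sub_sub,
        ← Finset.card_compl, hj]
      rfl
    obtain ⟨R', hRR', hR', C', hC', h⟩ := ih (insert a.1 R) {f ∈ F | z f = a} (by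
      intro f hf g hg x hx
      obtain ⟨hf, hfa⟩ := Finset.mem_filter.1 hf
      obtain ⟨hg, hga⟩ := Finset.mem_filter.1 hg
      rcases Finset.mem_insert.1 hx with rfl | hx
      · rw [← hfa, hz f hf, hfa, ← hga, ← hz g hg]
      · exact hF f hf g hg x hx) (by rwa [hcard']) hcard'
    exact ⟨R', (Finset.subset_insert _ _).trans hRR', hR', C',
      hC'.trans (Finset.filter_subset _ _), h⟩

section alphaDeg

variable {V : Type*} (T : SimpleGraph V) (s : ℕ)

lemma bddAbove_card_stable_low_degree [Finite V] :
    BddAbove {k | ∃ S : Finset V, S.card = k ∧ (∀ v ∈ S, (T.neighborSet v).ncard ≤ s) ∧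
      ∀ u ∈ S, ∀ v ∈ S, ¬ T.Adj u v} := by
  have := Fintype.ofFinite V
  refine ⟨Fintype.card V, ?_⟩
  rintro _ ⟨S, rfl, -⟩
  exact S.card_le_univ

lemma exists_card_eq_alphaDeg [Finite V] :
    ∃ S : Finset V, S.card = alphaDeg T s ∧ (∀ v ∈ S, (T.neighborSet v).ncard ≤ s) ∧
      ∀ u ∈ S, ∀ v ∈ S, ¬ T.Adj u v := by
  refine Nat.sSup_mem ?_ (bddAbove_card_stable_low_degree T s)
  exact ⟨0, ∅, by simp⟩

variable {T s} in
lemma card_le_alphaDeg [Finite V] {S : Finset V} (hdeg : ∀ v ∈ S, (T.neighborSet v).ncard ≤ s)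
    (hS : ∀ u ∈ S, ∀ v ∈ S, ¬ T.Adj u v) : S.card ≤ alphaDeg T s :=
  le_csSup (bddAbove_card_stable_low_degree T s) ⟨S, rfl, hdeg, hS⟩

end alphaDeg

/-- The copies of `H` in `G` are at most the injective homomorphisms. -/
lemma numCopies_le_ncard {α β : Type*} [Finite α] [Finite β] (H : SimpleGraph α)
    (G : SimpleGraph β) :
    numCopies H G ≤
      {f : α → β | Function.Injective f ∧ ∀ x y, H.Adj x y → G.Adj (f x) (f y)}.ncard := by
  rw [numCopies, ← Nat.card_coe_set_eq]
  let e (G' : {G' : G.Subgraph // Nonempty (G'.coe ≃g H)}) : H ≃g G'.1.coe := G'.2.some.symm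
  refine Nat.card_le_card_of_injective
    (fun G' => ⟨fun x => (e G' x : β), Subtype.val_injective.comp (e G').injective,
      fun x y h => G'.1.coe_adj_sub _ _ ((e G').map_adj_iff.2 h)⟩) ?_
  intro G₁ G₂ h
  have hfun : ∀ x, (e G₁ x : β) = e G₂ x := fun x => congrFun (congrArg Subtype.val h) x
  have hsymm : ∀ (G' : {G' : G.Subgraph // Nonempty (G'.coe ≃g H)}) b (hb : b ∈ G'.1.verts),
      ∃ x, (e G' x : β) = b := fun G' b hb => ⟨(e G').symm ⟨b, hb⟩, by simp⟩
  have hadj : ∀ (G' : {G' : G.Subgraph // Nonempty (G'.coe ≃g H)}) x y,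
      G'.1.Adj (e G' x) (e G' y) ↔ H.Adj x y := fun G' x y => (e G').map_adj_iff (v := x) (w := y)
  apply Subtype.ext
  refine Subgraph.ext (Set.ext fun b => ⟨fun hb => ?_, fun hb => ?_⟩) ?_
  · obtain ⟨x, rfl⟩ := hsymm _ b hb
    exact hfun x ▸ (e G₂ x).2
  · obtain ⟨x, rfl⟩ := hsymm _ b hb
    exact hfun x ▸ (e G₁ x).2
  · ext a b
    constructor <;> intro hab
    · obtain ⟨x, rfl⟩ := hsymm _ a hab.fst_mem
      obtain ⟨y, rfl⟩ := hsymm _ b hab.snd_mem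
      rwa [hfun, hfun, hadj, ← hadj G₁]
    · obtain ⟨x, rfl⟩ := hsymm _ a hab.fst_mem
      obtain ⟨y, rfl⟩ := hsymm _ b hab.snd_mem
      rwa [← hfun, ← hfun, hadj, ← hadj G₂]

/-- A sunflower of embedded forests whose kernel contains all vertices of degree at most `s`
gives a `K_{s+1,t}` minor. -/
lemma SimpleGraph.IsAcyclic.hasMinor_completeBipartiteGraph {α β : Type*} [Finite α]
    {T : SimpleGraph α} (hT : T.IsAcyclic) {G : SimpleGraph β} {s t : ℕ} (hs : 1 ≤ s) (ht : 1 ≤ t)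
    {R : Set α} (hR : R ≠ Set.univ) (hdeg : ∀ v ∉ R, s < (T.neighborSet v).ncard)
    {C : Finset (α → β)} (htC : t ≤ C.card) (hinj : ∀ f ∈ C, Function.Injective f)
    (hhom : ∀ f ∈ C, ∀ x y, T.Adj x y → G.Adj (f x) (f y))
    (hker : ∀ f ∈ C, ∀ g ∈ C, ∀ x ∈ R, f x = g x)
    (hpet : ∀ f ∈ C, ∀ g ∈ C, f ≠ g → ∀ x ∉ R, ∀ y ∉ R, f x ≠ g y) :
    HasMinor G (completeBipartiteGraph (Fin (s + 1)) (Fin t)) := by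
  obtain ⟨Q, hQc, hQR, hNR, hNs⟩ := hT.exists_connected_lt_ncard_neighbors hs hR hdeg
  set N := {w | w ∉ Q ∧ ∃ q ∈ Q, T.Adj q w}
  have hNfin : Fintype N := Fintype.ofFinite N
  obtain ⟨w⟩ : Nonempty (Fin (s + 1) ↪ N) := Function.Embedding.nonempty_of_card_le (by
    rw [Fintype.card_fin, ← Nat.card_eq_fintype_card, Nat.card_coe_set_eq]
    exact hNs)
  obtain ⟨φ⟩ : Nonempty (Fin t ↪ C) := Function.Embedding.nonempty_of_card_le (by simpa using htC)
  let i₀ : Fin t := ⟨0, ht⟩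
  have hw : ∀ a, (w a : α) ∈ R := fun a => hNR (w a).2
  refine ⟨Sum.elim (fun a => {(φ i₀).1 (w a)}) (fun i => (φ i).1 '' Q), ?_, ?_, ?_⟩
  · rintro (a | i)
    · exact Connected.of_subsingleton (V := ({(φ i₀).1 (w a)} : Set β))
    · let f : T.induce Q →g G.induce ((φ i).1 '' Q) :=
        ⟨fun x => ⟨(φ i).1 x, x, x.2, rfl⟩, fun {a b} hab => hhom _ (φ i).2 _ _ hab⟩
      refine hQc.map f ?_
      rintro ⟨_, x, hx, rfl⟩
      exact ⟨⟨x, hx⟩, rfl⟩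
  · have hsep : ∀ a i, (φ i₀).1 (w a) ∉ (φ i).1 '' Q := by
      rintro a i ⟨q, hq, h⟩
      rw [hker _ (φ i₀).2 _ (φ i).2 _ (hw a)] at h
      exact hQR hq (hinj _ (φ i).2 h ▸ hw a)
    rintro (a | i) (b | j) hab
    · refine Set.disjoint_singleton.2 fun h => hab ?_
      rw [w.injective (Subtype.ext (hinj _ (φ i₀).2 h))]
    · exact Set.disjoint_singleton_left.2 (hsep a j)
    · exact Set.disjoint_singleton_right.2 (hsep b i)
    · refine Set.disjoint_left.2 ?_
      rintro _ ⟨x, hx, rfl⟩ ⟨y, hy, h⟩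
      refine hpet _ (φ i).2 _ (φ j).2 (fun h => hab ?_) x (hQR hx) y (hQR hy) h.symm
      rw [φ.injective (Subtype.ext h)]
  · have hadj : ∀ a i, ∃ q ∈ Q, G.Adj ((φ i₀).1 (w a)) ((φ i).1 q) := by
      intro a i
      obtain ⟨-, q, hq, hqw⟩ := (w a).2
      refine ⟨q, hq, ?_⟩
      rw [hker _ (φ i₀).2 _ (φ i).2 _ (hw a)]
      exact hhom _ (φ i).2 _ _ hqw.symm
    rintro (a | i) (b | j) hab
    · simp at hab
    · obtain ⟨q, hq, h⟩ := hadj a j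
      exact ⟨_, rfl, _, ⟨q, hq, rfl⟩, h⟩
    · obtain ⟨q, hq, h⟩ := hadj b i
      exact ⟨_, ⟨q, hq, rfl⟩, _, rfl, h.symm⟩
    · simp at hab

lemma HasMinor.of_top_fin {α β : Type*} [Fintype β] {G : SimpleGraph α} (H : SimpleGraph β)
    (h : HasMinor G (⊤ : SimpleGraph (Fin (Fintype.card β)))) : HasMinor G H :=
  h.trans (HasMinor.of_hom ⟨Fintype.equivFin β, fun {a b} hab => by simpa using hab.ne⟩
    (Fintype.equivFin β).injective)

/-- A forest `T` has `O(n ^ α_s(T))` copies in graphs without `K_{s+1,t}` minor. -/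
theorem SimpleGraph.IsAcyclic.exists_numCopies_le {VT : Type*} [Fintype VT] {T : SimpleGraph VT}
    (hT : T.IsAcyclic) {s : ℕ} (hs : 1 ≤ s) (t : ℕ) :
    ∃ c : ℕ, ∀ (V : Type*) [Finite V] (G : SimpleGraph V),
      ¬ HasMinor G (completeBipartiteGraph (Fin (s + 1)) (Fin t)) →
      numCopies T G ≤ c * Nat.card V ^ alphaDeg T s := by
  classical
  obtain ⟨d, hd⟩ := exists_card_adj_le_of_not_hasMinor_top
    (Fintype.card (Fin (s + 1) ⊕ Fin t))
  let L : Finset VT := {v | (T.neighborSet v).ncard ≤ s}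
  let M := (Fintype.card VT * (Fintype.card VT * (t + 1))) ^ Lᶜ.card
  refine ⟨M * (d + 1) ^ alphaDeg T s, fun V _ G hG => ?_⟩
  have := Fintype.ofFinite V
  rw [Nat.card_eq_fintype_card]
  have hE := hd _ V G rfl fun h => hG (HasMinor.of_top_fin _ h)
  set D := (d + 1) * Fintype.card V with hD
  obtain ⟨S, hSL, hS, P, hPcard, hP⟩ := hT.exists_stable_card_restrict_le (G := G) (D := D)
    (by rw [hD, add_mul]; omega) (by rw [hD, add_mul]; omega) L
  have hSα : S.card ≤ alphaDeg T s :=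
    card_le_alphaDeg (fun v hv => by simpa [L] using hSL hv) hS
  let F : Finset (VT → V) :=
    {f | Function.Injective f ∧ ∀ x y, T.Adj x y → G.Adj (f x) (f y)}
  have hcop : numCopies T G ≤ F.card := by
    refine (numCopies_le_ncard T G).trans (le_of_eq ?_)
    rw [← Set.ncard_coe_finset]
    simp [F]
  have hFM : F.card ≤ P.card * M := by
    by_contra! hlt
    have hp : ∀ f ∈ F, ∃ p ∈ P, ∀ x ∈ L, p x = f x := fun f hf =>
      hP ⟨f, fun {a b} => (Finset.mem_filter.1 hf).2.2 a b⟩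
    obtain ⟨f₀, -⟩ := Finset.card_pos.1 (Nat.zero_lt_of_lt hlt)
    have : Nonempty (VT → V) := ⟨f₀⟩
    choose! p hpP hpL using hp
    obtain ⟨q, -, hq⟩ := Finset.exists_lt_card_fiber_of_mul_lt_card_of_maps_to hpP hlt
    obtain ⟨R, hLR, hR, C, hCF, htC, hker, hpet⟩ := exists_sunflower (t + 1) L {f ∈ F | p f = q} (by
      intro f hf g hg x hx
      obtain ⟨hf, hfq⟩ := Finset.mem_filter.1 hf
      obtain ⟨hg, hgq⟩ := Finset.mem_filter.1 hg
      rw [← hpL f hf x hx, ← hpL g hg x hx, hfq, hgq]) hq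
    have hCF' : ∀ f ∈ C, Function.Injective f ∧ ∀ x y, T.Adj x y → G.Adj (f x) (f y) :=
      fun f hf => (Finset.mem_filter.1 (Finset.mem_filter.1 (hCF hf)).1).2
    have hminor := hT.hasMinor_completeBipartiteGraph (G := G) hs (Nat.succ_pos t)
      (R := (R : Set VT))
      (by simpa using hR) (fun v hv => by
        by_contra! h
        exact hv (hLR (by simpa [L] using h))) htC (fun f hf => (hCF' f hf).1)
      (fun f hf => (hCF' f hf).2) (by simpa using hker) (by simpa using hpet)
    refine hG (hminor.trans (HasMinor.of_hom ⟨Sum.map id Fin.castSucc, ?_⟩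
      (Function.injective_id.sumMap (Fin.castSucc_injective t))))
    rintro (a | a) (b | b) h <;> simp_all
  refine hcop.trans ?_
  rcases F.eq_empty_or_nonempty with hF | ⟨f, hf⟩
  · simp [hF]
  rcases isEmpty_or_nonempty V with hV | hV
  · have hVT : IsEmpty VT := ⟨fun x => hV.elim (f x)⟩
    obtain ⟨S', hS', -⟩ := exists_card_eq_alphaDeg T s
    rw [Finset.eq_empty_of_isEmpty S', Finset.card_empty] at hS'
    rw [← hS'] at hSα ⊢
    have : S.card = 0 := by omega
    rw [this, pow_zero] at hPcard
    simpa using hFM.trans (Nat.mul_le_mul_right M hPcard)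
  · calc F.card ≤ P.card * M := hFM
      _ ≤ D ^ alphaDeg T s * M := by
        refine Nat.mul_le_mul_right M (hPcard.trans (Nat.pow_le_pow_right ?_ hSα))
        have := Fintype.card_pos (α := V)
        positivity
      _ = _ := by rw [hD, mul_pow]; ring

/-- Replacing pairwise nonadjacent vertices of degree at most `s` of a forest by independent sets
gives a graph in every minor-closed and `1`-sum-closed class containing all `K_{s,t}`. -/
lemma SimpleGraph.IsAcyclic.inClass_comap {𝓖 : ∀ n : ℕ, SimpleGraph (Fin n) → Prop}
    (hminor : MinorClosed 𝓖) (honesum : OneSumClosed 𝓖) {s : ℕ} (hs : 1 ≤ s)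
    (hsin : ∀ t : ℕ, 1 ≤ t → InClass 𝓖 (completeBipartiteGraph (Fin s) (Fin t)))
    {α : Type*} [Finite α] {T : SimpleGraph α} (hT : T.IsAcyclic) {S : Set α}
    (hS : ∀ u ∈ S, ∀ v ∈ S, ¬ T.Adj u v) (hdeg : ∀ v ∈ S, (T.neighborSet v).ncard ≤ s)
    {W : Type} [Finite W] {f : W → α} (hf : ∀ a b, f a = f b → f a ∉ S → a = b) :
    InClass 𝓖 (T.comap f) := by
  classical
  induction T using WellFoundedLT.induction generalizing W with
  | ind T ih =>
  have hrestrict : ∀ (Z : Set α) a b, T.Adj a b → a ∉ Z →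
      InClass 𝓖 ((T.comap f).induce (f ⁻¹' Z)) := by
    intro Z a b hab ha
    have hadj : ∀ x y, ((T.induce Z).spanningCoe).Adj x y ↔ T.Adj x y ∧ x ∈ Z ∧ y ∈ Z := by
      intro x y
      simp [SimpleGraph.map_adj]
    have hle : (T.induce Z).spanningCoe ≤ T := fun x y h => ((hadj x y).1 h).1
    have heq : (T.comap f).induce (f ⁻¹' Z) =
        (T.induce Z).spanningCoe.comap (fun w : f ⁻¹' Z => f w) := by
      ext x y
      simp only [comap_adj, hadj]
      exact ⟨fun h => ⟨h, x.2, y.2⟩, fun h => h.1⟩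
    rw [heq]
    refine ih _ (lt_of_le_of_ne hle fun h => ?_) (hT.anti hle)
      (fun u hu v hv h => hS u hu v hv (hle h))
      (fun v hv => le_trans (Set.ncard_le_ncard (fun x hx => hle hx) (Set.toFinite _)) (hdeg v hv))
      (fun x y hxy hx => Subtype.ext (hf _ _ hxy hx))
    rw [← h, hadj] at hab
    exact ha hab.2.1
  have hbase : ∀ {U : Type} [Finite U] (H : SimpleGraph U) (t : ℕ) (g : U → Fin s ⊕ Fin t),
      1 ≤ t → Function.Injective g →
      (∀ x y, H.Adj x y → (completeBipartiteGraph (Fin s) (Fin t)).Adj (g x) (g y)) →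
      InClass 𝓖 H := fun H t g ht hg hadj =>
    hminor.inClass_of_hasMinor (hsin t ht) (HasMinor.of_hom ⟨g, fun {x y} => hadj x y⟩ hg)
  obtain ⟨m, ⟨e⟩⟩ := Finite.exists_equiv_fin W
  have he : Function.Injective fun w => (e w).castSucc :=
    (Fin.castSucc_injective m).comp e.injective
  by_cases hE : ∀ a b, ¬ T.Adj a b
  · exact hbase _ (m + 1) (fun w => Sum.inr (e w).castSucc) (by omega)
      (Sum.inr_injective.comp he) fun x y h => (hE _ _ h).elim
  push Not at hE
  obtain ⟨u, v, huv⟩ := hE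
  by_cases hy : ∃ y ∉ S, ∃ x z, x ≠ z ∧ T.Adj y x ∧ T.Adj y z
  · obtain ⟨y, hyS, x, z, hxz, hyx, hyz⟩ := hy
    have hbridge := isBridge_iff.1 (isAcyclic_iff_forall_adj_isBridge.1 hT hyx.symm)
    set T' := T.deleteEdges {s(x, y)} with hT'
    let U : Set α := {a | T'.Reachable x a}
    have hxU : x ∈ U := Reachable.refl x
    have hyU : y ∉ U := hbridge
    have hcross : ∀ a b, T.Adj a b → a ∈ U → b ∉ U → a = x ∧ b = y := by
      intro a b hab ha hb
      by_contra hne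
      refine hb (Reachable.trans ha (Adj.reachable (deleteEdges_adj.2 ⟨hab, ?_⟩)))
      simp only [Set.mem_singleton_iff, Sym2.eq_iff]
      rintro (h | ⟨rfl, -⟩)
      · exact hne h
      · exact hyU ha
    have hzU : z ∉ U := fun h => hxz (hcross z y hyz.symm h hyU).1.symm
    refine honesum W inferInstance _ (f ⁻¹' insert y U) (f ⁻¹' Uᶜ) ?_ ?_ ?_
      (hrestrict _ z y hyz.symm ?_) (hrestrict _ x y hyx.symm fun h => h hxU)
    · ext w
      simp only [Set.mem_union, Set.mem_preimage, Set.mem_insert_iff, Set.mem_compl_iff,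
        Set.mem_univ, iff_true]
      tauto
    · refine (Set.ncard_le_one (Set.toFinite _)).2 ?_
      rintro a ⟨ha, ha'⟩ b ⟨hb, hb'⟩
      have ha : f a = y := (Set.mem_insert_iff.1 ha).resolve_right ha'
      have hb : f b = y := (Set.mem_insert_iff.1 hb).resolve_right hb'
      exact hf a b (ha.trans hb.symm) (ha ▸ hyS)
    · intro a b hab
      simp only [Set.mem_preimage, Set.mem_insert_iff, Set.mem_compl_iff]
      have h1 := hcross _ _ hab
      have h2 := hcross _ _ hab.symm
      tauto
    · exact fun h => (Set.mem_insert_iff.1 h).elim hyz.ne' hzU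
  · push Not at hy
    have huniq : ∀ y ∉ S, ∀ x z, T.Adj y x → T.Adj y z → x = z := fun y hyS x z hx hz => by
      by_contra hne
      exact hy y hyS x z hne hx hz
    obtain ⟨x, y, hxy, hxs, hxS⟩ : ∃ x y, T.Adj x y ∧ (T.neighborSet x).ncard ≤ s ∧
        ∀ z, T.Adj x z → z ∉ S := by
      by_cases hu : u ∈ S
      · exact ⟨u, v, huv, hdeg u hu, fun z hz hzS => hS u hu z hzS hz⟩
      by_cases hv : v ∈ S
      · exact ⟨v, u, huv.symm, hdeg v hv, fun z hz hzS => hS v hv z hzS hz⟩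
      refine ⟨u, v, huv, le_trans ((Set.ncard_le_one (Set.toFinite _)).2 ?_) hs, fun z hz => ?_⟩
      · exact fun a ha b hb => huniq u hu a b ha hb
      · exact huniq u hu v z huv hz ▸ hv
    refine honesum W inferInstance _ (f ⁻¹' insert x (T.neighborSet x))
      (f ⁻¹' (insert x (T.neighborSet x))ᶜ) ?_ ?_ ?_ ?_
      (hrestrict _ x y hxy fun h => h (Set.mem_insert _ _))
    · rw [Set.preimage_compl, Set.union_compl_self]
    · rw [Set.preimage_compl, Set.inter_compl_self, Set.ncard_empty]
      exact zero_le_one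
    · have hclosed : ∀ a b, T.Adj a b → a ∈ insert x (T.neighborSet x) →
          b ∈ insert x (T.neighborSet x) := by
        intro a b hab ha
        rcases Set.mem_insert_iff.1 ha with rfl | ha
        · exact Set.mem_insert_of_mem _ hab
        · exact Set.mem_insert_iff.2 (Or.inl (huniq a (hxS a ha) b x hab ha.symm))
      intro a b hab
      simp only [Set.mem_preimage, Set.mem_compl_iff]
      have h1 := hclosed _ _ hab
      have h2 := hclosed _ _ hab.symm
      tauto
    · have : Fintype (T.neighborSet x) := Fintype.ofFinite _
      obtain ⟨k⟩ : Nonempty (T.neighborSet x ↪ Fin s) := Function.Embedding.nonempty_of_card_le (by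
        rwa [Fintype.card_fin, ← Nat.card_eq_fintype_card, Nat.card_coe_set_eq])
      have hmem : ∀ w : f ⁻¹' insert x (T.neighborSet x), f w ≠ x → T.Adj x (f w) :=
        fun w hw => (Set.mem_insert_iff.1 w.2).resolve_left hw
      refine hbase _ (m + 1) (fun w => if h : f w = x then Sum.inr (e w).castSucc
        else Sum.inl (k ⟨f w, hmem w h⟩)) (by omega) ?_ ?_
      · intro a b hab
        by_cases ha : f a = x <;> by_cases hb : f b = x
        · simp only [ha, hb, dite_true, Sum.inr.injEq] at hab
          exact Subtype.ext (he hab)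
        · simp [ha, hb] at hab
        · simp [ha, hb] at hab
        · simp only [ha, hb, dite_false, Sum.inl.injEq] at hab
          have := congrArg Subtype.val (k.injective hab)
          exact Subtype.ext (hf _ _ this (hxS _ (hmem a ha)))
      · intro a b hab
        have hab : T.Adj (f a) (f b) := hab
        by_cases ha : f a = x
        · have hb : f b ≠ x := fun hb => hab.ne (ha.trans hb.symm)
          simp [ha, hb]
        · have hb : f b = x := huniq _ (hxS _ (hmem a ha)) _ _ hab (hmem a ha).symm
          simp [ha, hb]

/-- Copies with distinct vertex sets are distinct. -/
lemma card_le_numCopies {ι α β : Type*} [Finite β] {H : SimpleGraph α} {G : SimpleGraph β}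
    (g : ι → Copy H G) (hg : Function.Injective fun i => Set.range (g i)) :
    Nat.card ι ≤ numCopies H G := by
  refine Nat.card_le_card_of_injective
    (fun i => ⟨(g i).toSubgraph, ⟨(g i).isoToSubgraph.symm⟩⟩) fun i j hij => hg ?_
  have h := congrArg (fun G' => (Subtype.val G').verts) hij
  simpa [Copy.toSubgraph] using h

/-- A forest admits a map from any large enough `Fin n` which is injective outside the preimage of
a maximum stable set of vertices of degree at most `s`, with large fibres over that set, so that
the pulled back graph contains many copies of the forest. -/
lemma SimpleGraph.IsAcyclic.exists_comap_pow_le_numCopies {α : Type*} [Fintype α] [Nonempty α]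
    {T : SimpleGraph α} (hT : T.IsAcyclic) {s : ℕ} (hs : 1 ≤ s) {n : ℕ} (hn : Fintype.card α ≤ n) :
    ∃ (S : Set α) (f : Fin n → α), (∀ u ∈ S, ∀ v ∈ S, ¬ T.Adj u v) ∧
      (∀ v ∈ S, (T.neighborSet v).ncard ≤ s) ∧ (∀ a b, f a = f b → f a ∉ S → a = b) ∧
      (n / Fintype.card α) ^ alphaDeg T s ≤ numCopies T (T.comap f) := by
  classical
  obtain ⟨S, hSα, hdeg, hS⟩ := exists_card_eq_alphaDeg T s
  obtain ⟨v₀, hv₀⟩ : S.Nonempty := by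
    obtain ⟨x, -, hx⟩ := hT.exists_mem_subsingleton_neighbors (Finset.univ_nonempty (α := α))
    have h : ({x} : Finset α).card ≤ alphaDeg T s := card_le_alphaDeg
      (fun v hv => by
        rw [Finset.mem_singleton.1 hv]
        exact ((Set.ncard_le_one (Set.toFinite _)).2
          fun a ha b hb => hx a (by simp) b (by simp) ha hb).trans hs) (by simp)
    rw [Finset.card_singleton, ← hSα] at h
    exact Finset.card_pos.1 h
  set h := Fintype.card α with hh
  have hpos : 0 < h := Fintype.card_pos
  let e : α ≃ Fin h := Fintype.equivFin α
  let f₀ : Fin n → α := fun i => e.symm ⟨i % h, Nat.mod_lt _ hpos⟩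
  let f : Fin n → α := fun i => if f₀ i ∈ S ∨ (i : ℕ) < h then f₀ i else v₀
  have hf : ∀ i, f i ∉ S → f i = f₀ i ∧ (i : ℕ) < h := by
    intro i hi
    by_cases hc : f₀ i ∈ S ∨ (i : ℕ) < h
    · have : f i = f₀ i := if_pos hc
      rw [this] at hi ⊢
      exact ⟨rfl, hc.resolve_left hi⟩
    · have : f i = v₀ := if_neg hc
      exact (hi (this ▸ hv₀)).elim
  let q (p : S → Fin (n / h)) (v : α) : ℕ := if hv : v ∈ S then p ⟨v, hv⟩ else 0
  have hq : ∀ p v, q p v * h + e v < n := by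
    intro p v
    have hev := (e v).2
    have hqv : q p v < n / h := by
      by_cases hv : v ∈ S
      · simp [q, hv]
      · simpa [q, hv] using Nat.div_pos hn hpos
    have h1 := Nat.div_mul_le_self n h
    have h2 : (q p v + 1) * h ≤ n / h * h := Nat.mul_le_mul_right h hqv
    rw [add_mul] at h2
    omega
  let g (p : S → Fin (n / h)) (v : α) : Fin n := ⟨q p v * h + e v, hq p v⟩
  have hf₀g : ∀ p v, f₀ (g p v) = v := by
    intro p v
    simp only [f₀, g, Equiv.symm_apply_eq]
    ext
    simp [Nat.mod_eq_of_lt (e v).2]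
  have hfg : ∀ p v, f (g p v) = v := by
    intro p v
    have hc : f₀ (g p v) ∈ S ∨ (g p v : ℕ) < h := by
      rw [hf₀g]
      by_cases hv : v ∈ S
      · exact Or.inl hv
      · right
        simp [g, q, hv]
    exact (if_pos hc).trans (hf₀g p v)
  refine ⟨S, f, by simpa using hS, by simpa using hdeg, ?_, ?_⟩
  · intro a b hab ha
    obtain ⟨ha₁, ha₂⟩ := hf a ha
    obtain ⟨hb₁, hb₂⟩ := hf b (hab ▸ ha)
    have heq : f₀ a = f₀ b := ha₁ ▸ hb₁ ▸ hab
    simp only [f₀, e.symm.injective.eq_iff, Fin.mk.injEq, Nat.mod_eq_of_lt ha₂,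
      Nat.mod_eq_of_lt hb₂] at heq
    exact Fin.ext heq
  · have hcard : (n / h) ^ alphaDeg T s = Nat.card (S → Fin (n / h)) := by
      simp [Nat.card_eq_fintype_card, hSα]
    rw [hcard]
    refine card_le_numCopies (fun p => ⟨⟨g p, fun {x y} hxy => by simpa [hfg] using hxy⟩,
      (Function.LeftInverse.injective (hfg p))⟩) fun p p' hpp' => ?_
    have hrange : Set.range (g p) = Set.range (g p') := hpp'
    funext v
    obtain ⟨w, hw⟩ : g p v ∈ Set.range (g p') := hrange ▸ Set.mem_range_self _
    have hwv : w = v := by rw [← hfg p' w, hw, hfg]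
    rw [hwv, Fin.ext_iff] at hw
    have : q p' v = q p v := by
      simpa [g, hpos.ne'] using hw
    simpa [q, Fin.ext_iff] using this.symm

/-- For a minor-closed class `𝓖` whose minimal forbidden minors are all 2-connected
(equivalently, `𝓖` is closed under 1-sums), with `s` the maximum integer such that
`K_{s,t} ∈ 𝓖` for all `t`, we have `C(T,𝓖,n) ∈ Θ(n^{α_s(T)})` for every fixed forest `T`. -/
theorem stmt17 (𝓖 : ∀ n : ℕ, SimpleGraph (Fin n) → Prop)
    (hminor : MinorClosed 𝓖) (hexcl : ∃ (n : ℕ) (G : SimpleGraph (Fin n)), ¬ 𝓖 n G)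
    (honesum : OneSumClosed 𝓖)
    (s : ℕ) (hs : 1 ≤ s)
    (hsin : ∀ t : ℕ, 1 ≤ t → InClass 𝓖 (completeBipartiteGraph (Fin s) (Fin t)))
    (hsmax : ∃ t : ℕ, ¬ InClass 𝓖 (completeBipartiteGraph (Fin (s + 1)) (Fin t)))
    {VT : Type} [Fintype VT] (T : SimpleGraph VT) (hT : T.IsAcyclic) :
    ∃ c₁ c₂ : ℝ, 0 < c₁ ∧ 0 < c₂ ∧ ∃ N : ℕ,
      (∀ n : ℕ, N ≤ n → ∃ G : SimpleGraph (Fin n), 𝓖 n G ∧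
        c₁ * (n : ℝ) ^ (alphaDeg T s) ≤ (numCopies T G : ℝ)) ∧
      (∀ (V : Type) (G : SimpleGraph V), Finite V → InClass 𝓖 G →
        (numCopies T G : ℝ) ≤ c₂ * (Nat.card V : ℝ) ^ (alphaDeg T s)) := by
  obtain ⟨t, ht⟩ := hsmax
  obtain ⟨c, hc⟩ := hT.exists_numCopies_le hs t
  refine ⟨(1 / (2 * Fintype.card VT + 1)) ^ alphaDeg T s, c + 1, by positivity, by positivity,
    Fintype.card VT, fun n hn => ?_, fun V G _ hG => ?_⟩
  · have hmem : ∀ G : SimpleGraph (Fin n), InClass 𝓖 G → 𝓖 n G := by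
      rintro G ⟨G', ⟨e⟩, hG'⟩
      exact hminor _ _ G' G hG' (HasMinor.of_hom e.toHom e.injective)
    rcases isEmpty_or_nonempty VT with hVT | hVT
    · refine ⟨⊥, hmem _ (hminor.inClass_of_hasMinor (hsin (n + 1) (by omega))
        (HasMinor.of_hom ⟨fun i => Sum.inr i.castSucc, fun h => h.elim⟩
          (Sum.inr_injective.comp (Fin.castSucc_injective n)))), ?_⟩
      obtain ⟨S, hS, -⟩ := exists_card_eq_alphaDeg T s
      rw [Finset.eq_empty_of_isEmpty S, Finset.card_empty] at hS
      have h1 := card_le_numCopies (ι := Unit) (H := T) (G := (⊥ : SimpleGraph (Fin n)))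
        (fun _ => ⟨⟨hVT.elim, fun {a} => hVT.elim a⟩, fun a => hVT.elim a⟩)
        (Function.injective_of_subsingleton _)
      rw [Nat.card_unique] at h1
      simpa [← hS] using h1
    · obtain ⟨S, f, hS, hdeg, hf, hcopies⟩ := hT.exists_comap_pow_le_numCopies hs hn
      refine ⟨T.comap f, hmem _ (hT.inClass_comap hminor honesum hs hsin hS hdeg hf), ?_⟩
      refine le_trans ?_ (Nat.cast_le.2 hcopies)
      rw [← mul_pow, Nat.cast_pow]
      refine pow_le_pow_left₀ (by positivity) ?_ _
      have hpos : 0 < Fintype.card VT := Fintype.card_pos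
      rw [one_div, inv_mul_le_iff₀ (by positivity)]
      have h1 := Nat.lt_mul_div_succ n hpos
      have h2 := Nat.div_pos hn hpos
      norm_cast
      nlinarith
  · have hK : ¬ HasMinor G (completeBipartiteGraph (Fin (s + 1)) (Fin t)) := fun h =>
      ht (hminor.inClass_of_hasMinor hG h)
    calc (numCopies T G : ℝ) ≤ ((c * Nat.card V ^ alphaDeg T s : ℕ) : ℝ) :=
        Nat.cast_le.2 (hc V G hK)
      _ = c * (Nat.card V : ℝ) ^ alphaDeg T s := by push_cast; rfl
      _ ≤ _ := by gcongr; linarith
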